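/- (Corollary, graph form) Let 0 < r < R, a, b ∈ ℝ and H ∈ ℝ, and let A = {x ∈ ℝ² : r < |x| < R}. Suppose u is continuous on the closure of A, twice continuously differentiable on A, satisfies |∇u| < 1 on A and the constant mean curvature equation div(∇u/√(1 − |∇u|²)) = 2H on A, with u = a on the circle |x| = r and u = b on the circle |x| = R. Then u is rotationally symmetric: there exists a function g : [r, R] → ℝ such that u(x) = g(|x|) for all x in the closure of A. (Hence surfaces of revolution are the only compact spacelike surfaces in L³ with constant mean curvature bounded by two concentric circles in parallel planes.) -/

import Mathlib

open Real Set

/-- The gradient `∇u` of a function `u : ℝ² → ℝ`. -/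
noncomputable def grad2 (u : ℝ × ℝ → ℝ) (x : ℝ × ℝ) : ℝ × ℝ :=
  (fderiv ℝ u x (1, 0), fderiv ℝ u x (0, 1))

/-- The squared Euclidean norm `v₁² + v₂²` of a vector in `ℝ²`. -/
def sqnorm (v : ℝ × ℝ) : ℝ := v.1 ^ 2 + v.2 ^ 2

/-- The Euclidean norm `√(x₁² + x₂²)` of a point of `ℝ²`. -/
noncomputable def nrm (x : ℝ × ℝ) : ℝ := Real.sqrt (x.1 ^ 2 + x.2 ^ 2)

/-- The divergence `∂₁F₁ + ∂₂F₂` of a vector field `F : ℝ² → ℝ²`. -/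
noncomputable def div2 (F : ℝ × ℝ → ℝ × ℝ) (x : ℝ × ℝ) : ℝ :=
  fderiv ℝ (fun y => (F y).1) x (1, 0) + fderiv ℝ (fun y => (F y).2) x (0, 1)

/-- The vector field `∇u/√(1 − |∇u|²)`; the spacelike graph of `u` in Lorentz–Minkowski space
`L³ = (ℝ³, dx₁² + dx₂² − dx₃²)` has constant mean curvature `H` (with respect to the
future-directed Gauss map) exactly when `div(∇u/√(1 − |∇u|²)) = 2H`. -/
noncomputable def cmcField (u : ℝ × ℝ → ℝ) (y : ℝ × ℝ) : ℝ × ℝ :=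
  (Real.sqrt (1 - sqnorm (grad2 u y)))⁻¹ • grad2 u y

/-- At a local maximum, the second derivative of a function of one variable is nonpositive. -/
theorem IsLocalMax.deriv_deriv_nonpos {f : ℝ → ℝ} {t : ℝ} (hf : ContinuousAt f t)
    (hmax : IsLocalMax f t) : deriv (deriv f) t ≤ 0 := by
  by_contra! hpos
  have hmin := isLocalMin_of_deriv_deriv_pos hpos hmax.deriv_eq_zero hf
  have hconst : f =ᶠ[nhds t] fun _ => f t := by
    filter_upwards [hmax, hmin] with s h₁ h₂ using le_antisymm h₁ h₂
  have h := hconst.deriv.deriv_eq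
  simp at h
  linarith

/-- At a local maximum, the Hessian of a `C²` function is negative semidefinite. -/
theorem IsLocalMax.fderiv_fderiv_nonpos {E : Type*} [NormedAddCommGroup E] [NormedSpace ℝ E]
    {f : E → ℝ} {x : E} (hf : ContDiffAt ℝ 2 f x) (hmax : IsLocalMax f x) (h : E) :
    fderiv ℝ (fderiv ℝ f) x h h ≤ 0 := by
  have hline (t : ℝ) : HasDerivAt (fun t : ℝ => x + t • h) h t := by
    simpa using ((hasDerivAt_id t).smul_const h).const_add x
  have hcont : Filter.Tendsto (fun t : ℝ => x + t • h) (nhds 0) (nhds x) := by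
    simpa using (hline 0).continuousAt.tendsto
  have hderiv : deriv (fun t : ℝ => f (x + t • h)) =ᶠ[nhds 0]
      fun t => fderiv ℝ f (x + t • h) h := by
    filter_upwards [hcont.eventually (hf.eventually (by simp))] with t ht
    have hd : HasFDerivAt f (fderiv ℝ f (x + t • h)) (x + t • h) :=
      (ht.differentiableAt (by simp)).hasFDerivAt
    exact (hd.comp_hasDerivAt t (hline t)).deriv
  have hsecond : HasFDerivAt (fderiv ℝ f) (fderiv ℝ (fderiv ℝ f) x) (x + (0 : ℝ) • h) := by
    simpa using ((hf.fderiv_right (m := 1) (by norm_num)).differentiableAt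
      (by simp)).hasFDerivAt
  have hderiv₂ : deriv (deriv fun t : ℝ => f (x + t • h)) 0 = fderiv ℝ (fderiv ℝ f) x h h := by
    rw [hderiv.deriv_eq]
    have hline₂ : HasDerivAt (fun t : ℝ => fderiv ℝ f (x + t • h)) (fderiv ℝ (fderiv ℝ f) x h)
        0 := hsecond.comp_hasDerivAt (0 : ℝ) (hline 0)
    exact ((ContinuousLinearMap.apply ℝ ℝ h).hasFDerivAt.comp_hasDerivAt (0 : ℝ) hline₂).deriv
  rw [← hderiv₂]
  refine IsLocalMax.deriv_deriv_nonpos ?_ ?_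
  · have : ContinuousAt f (x + (0 : ℝ) • h) := by simpa using hf.continuousAt
    exact this.comp (f := fun t : ℝ => x + t • h) (hline 0).continuousAt
  · have := hcont.eventually hmax
    simpa [IsLocalMax, IsMaxFilter] using this

/-- The constant mean curvature equation in nondivergence form,
`(1 − |∇u|²) Δu + D²u(∇u, ∇u) = 2H (1 − |∇u|²)^{3/2}`, at the point `x`. -/
def IsCMCAt (H : ℝ) (u : ℝ × ℝ → ℝ) (x : ℝ × ℝ) : Prop :=
  (1 - sqnorm (grad2 u x)) * (fderiv ℝ (fderiv ℝ u) x (1, 0) (1, 0) +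
      fderiv ℝ (fderiv ℝ u) x (0, 1) (0, 1)) +
    fderiv ℝ (fderiv ℝ u) x (grad2 u x) (grad2 u x) =
  2 * H * √(1 - sqnorm (grad2 u x)) ^ 3

theorem clm_apply_prod (f : ℝ × ℝ →L[ℝ] ℝ) (v : ℝ × ℝ) :
    f v = v.1 * f (1, 0) + v.2 * f (0, 1) := by
  have hv : v = v.1 • ((1, 0) : ℝ × ℝ) + v.2 • ((0, 1) : ℝ × ℝ) := by ext <;> simp
  conv_lhs => rw [hv]
  simp only [map_add, map_smul, smul_eq_mul]

theorem clm_apply₂_prod (B : ℝ × ℝ →L[ℝ] ℝ × ℝ →L[ℝ] ℝ) (v w : ℝ × ℝ) :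
    B v w = v.1 * w.1 * B (1, 0) (1, 0) + v.1 * w.2 * B (1, 0) (0, 1) +
      v.2 * w.1 * B (0, 1) (1, 0) + v.2 * w.2 * B (0, 1) (0, 1) := by
  have hv : v = v.1 • ((1, 0) : ℝ × ℝ) + v.2 • ((0, 1) : ℝ × ℝ) := by ext <;> simp
  conv_lhs => rw [hv]
  simp only [map_add, map_smul, add_apply, smul_apply, smul_eq_mul]
  rw [clm_apply_prod (B (1, 0)) w, clm_apply_prod (B (0, 1)) w]
  ring

theorem hasFDerivAt_fderiv {E : Type*} [NormedAddCommGroup E] [NormedSpace ℝ E]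
    {u : E → ℝ} {x : E} (hu : ContDiffAt ℝ 2 u x) :
    HasFDerivAt (fderiv ℝ u) (fderiv ℝ (fderiv ℝ u) x) x :=
  ((hu.fderiv_right (m := 1) (by norm_num)).differentiableAt (by simp)).hasFDerivAt

theorem isCMCAt_of_div2 {H : ℝ} {u : ℝ × ℝ → ℝ} {x : ℝ × ℝ} (hu : ContDiffAt ℝ 2 u x)
    (hs : sqnorm (grad2 u x) < 1) (hdiv : div2 (cmcField u) x = 2 * H) : IsCMCAt H u x := by
  have hA := hasFDerivAt_fderiv hu
  unfold IsCMCAt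
  set A := fderiv ℝ (fderiv ℝ u) x
  have h₁ : HasFDerivAt (fun y => fderiv ℝ u y (1, 0)) (A.flip (1, 0)) x := by
    simpa using hA.clm_apply (hasFDerivAt_const ((1, 0) : ℝ × ℝ) x)
  have h₂ : HasFDerivAt (fun y => fderiv ℝ u y (0, 1)) (A.flip (0, 1)) x := by
    simpa using hA.clm_apply (hasFDerivAt_const ((0, 1) : ℝ × ℝ) x)
  have hpos : 0 < 1 - sqnorm (grad2 u x) := by linarith
  have hW : 0 < √(1 - sqnorm (grad2 u x)) := Real.sqrt_pos.2 hpos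
  have hW2 : √(1 - sqnorm (grad2 u x)) ^ 2 = 1 - sqnorm (grad2 u x) := Real.sq_sqrt hpos.le
  have hw := (((h₁.pow 2).add (h₂.pow 2)).const_sub 1).sqrt hpos.ne'
  have hwi := (hasDerivAt_inv hW.ne').comp_hasFDerivAt x hw
  have e₁ : fderiv ℝ (fun y => (cmcField u y).1) x = _ := (hwi.mul h₁).fderiv
  have e₂ : fderiv ℝ (fun y => (cmcField u y).2) x = _ := (hwi.mul h₂).fderiv
  rw [div2, e₁, e₂] at hdiv
  rw [clm_apply₂_prod A (grad2 u x)]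
  simp at hdiv
  simp only [sqnorm, grad2] at hdiv hW hW2 ⊢
  generalize √_ = W at hdiv hW hW2 ⊢
  rw [← hdiv, ← hW2]
  field_simp
  ring

/-- The rotation of the plane with cosine `c` and sine `s`. -/
noncomputable def planeRotation (c s : ℝ) : ℝ × ℝ →L[ℝ] ℝ × ℝ :=
  (c • ContinuousLinearMap.fst ℝ ℝ ℝ - s • ContinuousLinearMap.snd ℝ ℝ ℝ).prod
    (s • ContinuousLinearMap.fst ℝ ℝ ℝ + c • ContinuousLinearMap.snd ℝ ℝ ℝ)

theorem planeRotation_apply (c s : ℝ) (x : ℝ × ℝ) :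
    planeRotation c s x = (c * x.1 - s * x.2, s * x.1 + c * x.2) := by
  simp [planeRotation]

theorem nrm_planeRotation {c s : ℝ} (h : c ^ 2 + s ^ 2 = 1) (x : ℝ × ℝ) :
    nrm (planeRotation c s x) = nrm x := by
  rw [nrm, nrm, planeRotation_apply]
  congr 1
  linear_combination (x.1 ^ 2 + x.2 ^ 2) * h

theorem exists_planeRotation_eq {x y : ℝ × ℝ} (hx : 0 < nrm x) (hxy : nrm x = nrm y) :
    ∃ c s : ℝ, c ^ 2 + s ^ 2 = 1 ∧ planeRotation c s x = y := by
  have hx2 : nrm x ^ 2 = x.1 ^ 2 + x.2 ^ 2 := Real.sq_sqrt (by positivity)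
  have hy2 : nrm y ^ 2 = y.1 ^ 2 + y.2 ^ 2 := Real.sq_sqrt (by positivity)
  have hsq : x.1 ^ 2 + x.2 ^ 2 = y.1 ^ 2 + y.2 ^ 2 := by rw [← hx2, ← hy2, hxy]
  have hne : x.1 ^ 2 + x.2 ^ 2 ≠ 0 := by rw [← hx2]; positivity
  refine ⟨(x.1 * y.1 + x.2 * y.2) / (x.1 ^ 2 + x.2 ^ 2),
    (x.1 * y.2 - x.2 * y.1) / (x.1 ^ 2 + x.2 ^ 2), ?_, ?_⟩
  · field_simp
    linear_combination -(x.1 ^ 2 + x.2 ^ 2) * hsq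
  · rw [planeRotation_apply]
    ext
    · field_simp
      ring
    · field_simp
      ring

theorem fderiv_comp_clm {E : Type*} [NormedAddCommGroup E] [NormedSpace ℝ E] {u : E → ℝ}
    (L : E →L[ℝ] E) {x : E} (hu : DifferentiableAt ℝ u (L x)) :
    fderiv ℝ (fun y => u (L y)) x = (fderiv ℝ u (L x)).comp L :=
  (hu.hasFDerivAt.comp x L.hasFDerivAt).fderiv

theorem fderiv_fderiv_comp_clm {E : Type*} [NormedAddCommGroup E] [NormedSpace ℝ E] {u : E → ℝ}
    (L : E →L[ℝ] E) {x : E} (hu : ContDiffAt ℝ 2 u (L x)) (h k : E) :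
    fderiv ℝ (fderiv ℝ fun y => u (L y)) x h k = fderiv ℝ (fderiv ℝ u) (L x) (L h) (L k) := by
  have hev : (fderiv ℝ fun y => u (L y)) =ᶠ[nhds x] fun y => (fderiv ℝ u (L y)).comp L := by
    filter_upwards [L.continuous.continuousAt.eventually (hu.eventually (by simp))] with y hy
    exact fderiv_comp_clm L (hy.differentiableAt (by simp))
  have := ((hasFDerivAt_fderiv hu).comp x L.hasFDerivAt).clm_comp (hasFDerivAt_const L x)
  have heq := hev.fderiv_eq.trans this.fderiv
  rw [heq]
  simp

theorem grad2_comp_planeRotation {c s : ℝ} {u : ℝ × ℝ → ℝ} {x : ℝ × ℝ}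
    (hu : DifferentiableAt ℝ u (planeRotation c s x)) :
    grad2 (fun y => u (planeRotation c s y)) x =
      planeRotation c (-s) (grad2 u (planeRotation c s x)) := by
  rw [grad2, fderiv_comp_clm _ hu, planeRotation_apply]
  simp only [ContinuousLinearMap.comp_apply]
  rw [clm_apply_prod _ (planeRotation c s (1, 0)), clm_apply_prod _ (planeRotation c s (0, 1))]
  simp [planeRotation_apply, grad2]

theorem sqnorm_planeRotation {c s : ℝ} (h : c ^ 2 + s ^ 2 = 1) (x : ℝ × ℝ) :
    sqnorm (planeRotation c s x) = sqnorm x := by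
  rw [sqnorm, sqnorm, planeRotation_apply]
  linear_combination (x.1 ^ 2 + x.2 ^ 2) * h

theorem IsCMCAt.comp_planeRotation {H c s : ℝ} (h : c ^ 2 + s ^ 2 = 1) {u : ℝ × ℝ → ℝ}
    {x : ℝ × ℝ} (hu : ContDiffAt ℝ 2 u (planeRotation c s x))
    (hcmc : IsCMCAt H u (planeRotation c s x)) :
    IsCMCAt H (fun y => u (planeRotation c s y)) x := by
  have h' : c ^ 2 + (-s) ^ 2 = 1 := by simpa using h
  have hinv (p : ℝ × ℝ) : planeRotation c s (planeRotation c (-s) p) = p := by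
    simp only [planeRotation_apply]
    ext
    · simp only
      linear_combination p.1 * h
    · simp only
      linear_combination p.2 * h
  unfold IsCMCAt at hcmc ⊢
  simp only [fderiv_fderiv_comp_clm _ hu, grad2_comp_planeRotation (hu.differentiableAt (by simp)),
    sqnorm_planeRotation h', hinv]
  rw [← hcmc, clm_apply₂_prod _ (planeRotation c s (1, 0)),
    clm_apply₂_prod _ (planeRotation c s (0, 1))]
  simp only [planeRotation_apply]
  generalize fderiv ℝ (fderiv ℝ u) _ = B
  linear_combination (1 - sqnorm (grad2 u (c * x.1 - s * x.2, s * x.1 + c * x.2))) *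
    (B (1, 0) (1, 0) + B (0, 1) (0, 1)) * h

theorem abs_sqrt_pow_three_sub_le {s t : ℝ} (hs : 0 ≤ s) (hs₁ : s ≤ 1) (ht : 0 ≤ t)
    (ht₁ : t ≤ 1) : |√s ^ 3 - √t ^ 3| ≤ 2 * |s - t| := by
  have hS := Real.sqrt_nonneg s
  have hT := Real.sqrt_nonneg t
  have hS₁ : √s ≤ 1 := Real.sqrt_le_one.2 hs₁
  have hT₁ : √t ≤ 1 := Real.sqrt_le_one.2 ht₁
  have e : s - t = (√s - √t) * (√s + √t) := by
    linear_combination -(Real.sq_sqrt hs) + Real.sq_sqrt ht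
  have e' : √s ^ 3 - √t ^ 3 = (√s - √t) * (√s ^ 2 + √s * √t + √t ^ 2) := by ring
  rw [e, e', abs_mul, abs_mul, abs_of_nonneg (a := √s + √t) (by positivity),
    abs_of_nonneg (a := √s ^ 2 + √s * √t + √t ^ 2) (by positivity)]
  nlinarith [mul_le_mul_of_nonneg_left (show √s ^ 2 + √s * √t + √t ^ 2 ≤ 2 * (√s + √t) by
    nlinarith [mul_nonneg hS hT]) (abs_nonneg (√s - √t))]

/-- The algebraic core of the comparison principle: two spacelike solutions whose difference
touches `-ε exp (γ x₁)` from below, with `h = ε γ exp (γ x₁)`, force a bound on `γ`. -/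
theorem gamma_mul_le_of_touching {H γ h : ℝ} (hh : 0 < h) {p q : ℝ × ℝ}
    (hq : q = (p.1 + h, p.2)) (hp₁ : sqnorm p < 1) (hq₁ : sqnorm q < 1)
    {A B : ℝ × ℝ →L[ℝ] ℝ × ℝ →L[ℝ] ℝ}
    (hA : (1 - sqnorm p) * (A (1, 0) (1, 0) + A (0, 1) (0, 1)) + A p p =
      2 * H * √(1 - sqnorm p) ^ 3)
    (hB : (1 - sqnorm q) * (B (1, 0) (1, 0) + B (0, 1) (0, 1)) + B q q =
      2 * H * √(1 - sqnorm q) ^ 3)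
    (hAB : ∀ v : ℝ × ℝ, A v v - B v v + γ * h * v.1 ^ 2 ≤ 0) :
    γ * (1 - p.2 ^ 2) ≤
      8 * |H| + (|B (1, 0) (0, 1)| + |B (0, 1) (1, 0)| + 2 * |B (0, 1) (0, 1)|) := by
  have hs := abs_sqrt_pow_three_sub_le (s := 1 - sqnorm p) (t := 1 - sqnorm q) (by linarith)
    (by unfold sqnorm; nlinarith [sq_nonneg p.1, sq_nonneg p.2]) (by linarith)
    (by unfold sqnorm; nlinarith [sq_nonneg q.1, sq_nonneg q.2])
  have k₁ := hAB (1, 0)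
  have k₂ := hAB (0, 1)
  have k₃ := hAB p
  rw [clm_apply₂_prod B q] at hB
  rw [clm_apply₂_prod B p] at k₃
  subst hq
  simp only [sqnorm] at *
  have hp1 : |p.1| ≤ 1 := abs_le_one_iff_mul_self_le_one.2 (by nlinarith [sq_nonneg p.2])
  have hp2 : |p.2| ≤ 1 := abs_le_one_iff_mul_self_le_one.2 (by nlinarith [sq_nonneg p.1])
  have hq1 : |p.1 + h| ≤ 1 := abs_le_one_iff_mul_self_le_one.2 (by nlinarith [sq_nonneg p.2])
  have hsum : |p.1 + p.1 + h| ≤ 2 := by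
    rw [abs_le] at *
    constructor <;> linarith [hp1.1, hp1.2, hq1.1, hq1.2]
  have hS : |√(1 - (p.1 ^ 2 + p.2 ^ 2)) ^ 3 - √(1 - ((p.1 + h) ^ 2 + p.2 ^ 2)) ^ 3| ≤ 4 * h := by
    refine hs.trans ?_
    rw [show 1 - (p.1 ^ 2 + p.2 ^ 2) - (1 - ((p.1 + h) ^ 2 + p.2 ^ 2)) = (p.1 + p.1 + h) * h by
      ring, abs_mul, abs_of_pos hh]
    nlinarith
  have hHS : -(|H| * (4 * h)) ≤
      H * (√(1 - (p.1 ^ 2 + p.2 ^ 2)) ^ 3 - √(1 - ((p.1 + h) ^ 2 + p.2 ^ 2)) ^ 3) := by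
    refine le_trans (neg_le_neg ?_) (neg_abs_le _)
    rw [abs_mul]
    gcongr
  have hb (y z : ℝ) (k : ℝ) (hk : |y| ≤ k) : -(k * |z|) ≤ y * z := by
    refine le_trans (neg_le_neg ?_) (neg_abs_le _)
    rw [abs_mul]
    gcongr
  have b₁ := mul_le_mul_of_nonneg_left (hb p.2 (B (1, 0) (0, 1)) 1 hp2) hh.le
  have b₂ := mul_le_mul_of_nonneg_left (hb p.2 (B (0, 1) (1, 0)) 1 hp2) hh.le
  have b₃ := mul_le_mul_of_nonneg_left
    (hb (-(p.1 + p.1 + h)) (B (0, 1) (0, 1)) 2 (by rwa [abs_neg])) hh.le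
  have d : 0 ≤ 1 - (p.1 ^ 2 + p.2 ^ 2) := by linarith
  have m₁ := mul_le_mul_of_nonneg_left k₁ d
  have m₂ := mul_le_mul_of_nonneg_left k₂ d
  refine le_of_mul_le_mul_left ?_ hh
  nlinarith

/-- Comparison principle for the constant mean curvature equation: no regularity up to the
boundary is required beyond continuity. -/
theorem cmc_comparison {H : ℝ} {Ω S : Set (ℝ × ℝ)} (hΩ : IsOpen Ω) (hS : IsCompact S)
    (hΩS : Ω ⊆ S) {u v : ℝ × ℝ → ℝ} (huc : ContinuousOn u S) (hvc : ContinuousOn v S)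
    (hu : ContDiffOn ℝ 2 u Ω) (hv : ContDiffOn ℝ 2 v Ω)
    (hus : ∀ x ∈ Ω, sqnorm (grad2 u x) < 1) (hvs : ∀ x ∈ Ω, sqnorm (grad2 v x) < 1)
    (hum : ∀ x ∈ Ω, IsCMCAt H u x) (hvm : ∀ x ∈ Ω, IsCMCAt H v x)
    (hbd : ∀ x ∈ S, x ∉ Ω → u x ≤ v x) : ∀ x ∈ S, u x ≤ v x := by
  by_contra! hcon
  obtain ⟨x₀, hx₀, hlt⟩ := hcon
  obtain ⟨m, hm⟩ : ∃ m, m = u x₀ - v x₀ := ⟨_, rfl⟩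
  have hmpos : 0 < m := by linarith
  have hwc : ContinuousOn (fun x => u x - v x) S := huc.sub hvc
  have hK : IsCompact (S ∩ (fun x => u x - v x) ⁻¹' Ici (m / 2)) :=
    hS.of_isClosed_subset (hwc.preimage_isClosed_of_isClosed hS.isClosed isClosed_Ici)
      inter_subset_left
  set K := S ∩ (fun x => u x - v x) ⁻¹' Ici (m / 2)
  have hKΩ : K ⊆ Ω := by
    rintro x ⟨hxS, hx⟩
    by_contra hxΩ
    have := hbd x hxS hxΩ
    simp only [mem_preimage, mem_Ici] at hx
    linarith
  have hduc : ContinuousOn (fderiv ℝ u) K :=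
    (hu.continuousOn_fderiv_of_isOpen hΩ (by norm_num)).mono hKΩ
  have hddv : ContinuousOn (fderiv ℝ (fderiv ℝ v)) K :=
    ((hv.fderiv_of_isOpen hΩ (m := 1) (by norm_num)).continuousOn_fderiv_of_isOpen hΩ
      (by norm_num)).mono hKΩ
  have hgu : ContinuousOn (fun x => 1 - (fderiv ℝ u x (0, 1)) ^ 2) K :=
    continuousOn_const.sub ((hduc.clm_apply continuousOn_const).pow 2)
  have hBv (a b : ℝ × ℝ) : ContinuousOn (fun x => |fderiv ℝ (fderiv ℝ v) x a b|) K :=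
    ((hddv.clm_apply continuousOn_const).clm_apply continuousOn_const).abs
  have hx₀K : x₀ ∈ K := ⟨hx₀, by simp only [mem_preimage, mem_Ici]; linarith⟩
  obtain ⟨z, hzK, hz⟩ := hK.exists_isMinOn ⟨x₀, hx₀K⟩ hgu
  have hc : 0 < 1 - (fderiv ℝ u z (0, 1)) ^ 2 := by
    have := hus z (hKΩ hzK)
    simp only [sqnorm, grad2] at this
    nlinarith [sq_nonneg (fderiv ℝ u z (1, 0))]
  obtain ⟨C, hC⟩ := hK.bddAbove_image
    (((hBv (1, 0) (0, 1)).add (hBv (0, 1) (1, 0))).add ((hBv (0, 1) (0, 1)).const_smul (2 : ℝ)))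
  obtain ⟨γ, hγ₀, hγ⟩ : ∃ γ : ℝ, 0 < γ ∧ 8 * |H| + C < γ * (1 - (fderiv ℝ u z (0, 1)) ^ 2) := by
    refine ⟨(|8 * |H| + C| + 1) / (1 - (fderiv ℝ u z (0, 1)) ^ 2), by positivity, ?_⟩
    rw [div_mul_cancel₀ _ hc.ne']
    linarith [le_abs_self (8 * |H| + C)]
  have hexpc : Continuous fun x : ℝ × ℝ => Real.exp (γ * x.1) := by fun_prop
  obtain ⟨D, hD⟩ := hS.bddAbove_image hexpc.continuousOn
  have hD' (x) (hx : x ∈ S) : Real.exp (γ * x.1) ≤ D := hD (mem_image_of_mem _ hx)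
  have hDpos : 0 < D := (Real.exp_pos _).trans_le (hD' x₀ hx₀)
  obtain ⟨ε, hε₀, hε⟩ : ∃ ε : ℝ, 0 < ε ∧ ε * D = m / 2 :=
    ⟨m / 2 / D, by positivity, div_mul_cancel₀ _ hDpos.ne'⟩
  have hφc : ContinuousOn (fun x => u x - v x + ε * Real.exp (γ * x.1)) S :=
    hwc.add (continuousOn_const.mul hexpc.continuousOn)
  obtain ⟨y, hyS, hy⟩ := hS.exists_isMaxOn ⟨x₀, hx₀⟩ hφc
  have hyK : y ∈ K := by
    refine ⟨hyS, ?_⟩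
    have h₁ := hy hx₀
    have h₂ := mul_le_mul_of_nonneg_left (hD' y hyS) hε₀.le
    have h₃ := mul_pos hε₀ (Real.exp_pos (γ * x₀.1))
    simp only [mem_ofPred_eq] at h₁
    simp only [mem_preimage, mem_Ici]
    linarith
  have hyΩ := hKΩ hyK
  have hΩy : Ω ∈ nhds y := hΩ.mem_nhds hyΩ
  have hmax : IsLocalMax (fun x => u x - v x + ε * Real.exp (γ * x.1)) y :=
    hy.isLocalMax (Filter.mem_of_superset hΩy hΩS)
  have hψ (x : ℝ × ℝ) : HasFDerivAt (fun x : ℝ × ℝ => ε * Real.exp (γ * x.1))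
      ((ε * γ * Real.exp (γ * x.1)) • ContinuousLinearMap.fst ℝ ℝ ℝ) x := by
    have := ((hasFDerivAt_fst (𝕜 := ℝ) (p := x)).const_mul γ).exp.const_mul ε
    exact this.congr_fderiv (by simp only [smul_smul]; ring_nf)
  have hdφ : (fderiv ℝ fun x => u x - v x + ε * Real.exp (γ * x.1)) =ᶠ[nhds y]
      fun x => fderiv ℝ u x - fderiv ℝ v x +
        (ε * γ * Real.exp (γ * x.1)) • ContinuousLinearMap.fst ℝ ℝ ℝ := by
    filter_upwards [hΩy] with x hx
    have hux := (hu.contDiffAt (hΩ.mem_nhds hx)).differentiableAt (by simp)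
    have hvx := (hv.contDiffAt (hΩ.mem_nhds hx)).differentiableAt (by simp)
    exact ((hux.hasFDerivAt.sub hvx.hasFDerivAt).add (hψ x)).fderiv
  have huy := hu.contDiffAt hΩy
  have hvy := hv.contDiffAt hΩy
  have hddψ : HasFDerivAt (fun x : ℝ × ℝ =>
      (ε * γ * Real.exp (γ * x.1)) • ContinuousLinearMap.fst ℝ ℝ ℝ)
      (((ε * γ) • Real.exp (γ * y.1) • γ • ContinuousLinearMap.fst ℝ ℝ ℝ).smulRight
        (ContinuousLinearMap.fst ℝ ℝ ℝ)) y :=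
    (((hasFDerivAt_fst (𝕜 := ℝ) (p := y)).const_mul γ).exp.const_mul (ε * γ)).smul_const
      (ContinuousLinearMap.fst ℝ ℝ ℝ)
  have hddφ := (((hasFDerivAt_fderiv huy).sub (hasFDerivAt_fderiv hvy)).add hddψ).fderiv
  have hgrad := hmax.fderiv_eq_zero
  rw [hdφ.eq_of_nhds] at hgrad
  have hψ2 : ContDiff ℝ 2 fun x : ℝ × ℝ => ε * Real.exp (γ * x.1) := by fun_prop
  have hhess := hmax.fderiv_fderiv_nonpos ((huy.sub hvy).add hψ2.contDiffAt)
  have hkey := gamma_mul_le_of_touching (H := H) (γ := γ) (h := ε * γ * Real.exp (γ * y.1))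
    (by positivity) (p := grad2 u y) (q := grad2 v y) ?_ (hus y hyΩ) (hvs y hyΩ)
    (hum y hyΩ) (hvm y hyΩ) ?_
  · have h₁ := hC (mem_image_of_mem _ hyK)
    have h₂ : 1 - (fderiv ℝ u z (0, 1)) ^ 2 ≤ 1 - (fderiv ℝ u y (0, 1)) ^ 2 := hz hyK
    have h₃ := mul_le_mul_of_nonneg_left h₂ hγ₀.le
    simp only [grad2, Pi.add_apply, Pi.smul_apply, smul_eq_mul] at h₁ hkey
    linarith
  · have g₁ := DFunLike.congr_fun hgrad (1, 0)
    have g₂ := DFunLike.congr_fun hgrad (0, 1)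
    simp at g₁ g₂
    ext
    · simp only [grad2]; linarith
    · simp only [grad2]; linarith
  · intro w
    have := hhess w
    rw [hdφ.fderiv_eq.trans hddφ] at this
    simp at this
    linarith

/-- Corollary (graph form): a function `u`, continuous on the closed annulus
`{r ≤ |x| ≤ R}`, `C²` with `|∇u| < 1` on the open annulus `A = {r < |x| < R}`, satisfying the
constant mean curvature equation `div(∇u/√(1 − |∇u|²)) = 2H` on `A`, with `u = a` on
`|x| = r` and `u = b` on `|x| = R`, is rotationally symmetric: `u(x) = g(|x|)` for some
`g : [r, R] → ℝ`.  Hence surfaces of revolution are the only compact spacelike surfaces in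
`L³` with constant mean curvature bounded by two concentric circles in parallel planes. -/
theorem annulus_rotational (r R a b H : ℝ) (hr : 0 < r) (hrR : r < R)
    (u : ℝ × ℝ → ℝ)
    (hu_cont : ContinuousOn u {x | r ≤ nrm x ∧ nrm x ≤ R})
    (hu_reg : ContDiffOn ℝ 2 u {x | r < nrm x ∧ nrm x < R})
    (hu_spacelike : ∀ x : ℝ × ℝ, r < nrm x → nrm x < R → sqnorm (grad2 u x) < 1)
    (hu_cmc : ∀ x : ℝ × ℝ, r < nrm x → nrm x < R → div2 (cmcField u) x = 2 * H)
    (hu_a : ∀ x : ℝ × ℝ, nrm x = r → u x = a)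
    (hu_b : ∀ x : ℝ × ℝ, nrm x = R → u x = b) :
    ∃ g : ℝ → ℝ, ∀ x : ℝ × ℝ, r ≤ nrm x → nrm x ≤ R → u x = g (nrm x) := by
  have hnc : Continuous nrm := by unfold nrm; fun_prop
  have hΩ : IsOpen {x | r < nrm x ∧ nrm x < R} :=
    (isOpen_lt continuous_const hnc).inter (isOpen_lt hnc continuous_const)
  have hcl : IsClosed {x | r ≤ nrm x ∧ nrm x ≤ R} :=
    (isClosed_le continuous_const hnc).inter (isClosed_le hnc continuous_const)
  have hS : IsCompact {x | r ≤ nrm x ∧ nrm x ≤ R} := by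
    refine (isCompact_closedBall (0 : ℝ × ℝ) R).of_isClosed_subset hcl ?_
    rintro x ⟨-, hx⟩
    have h₁ : |x.1| ≤ nrm x := Real.abs_le_sqrt (by nlinarith [sq_nonneg x.2])
    have h₂ : |x.2| ≤ nrm x := Real.abs_le_sqrt (by nlinarith [sq_nonneg x.1])
    rw [mem_closedBall_zero_iff, Prod.norm_def]
    exact max_le (h₁.trans hx) (h₂.trans hx)
  have hC2 (x : ℝ × ℝ) (h₁ : r < nrm x) (h₂ : nrm x < R) : ContDiffAt ℝ 2 u x :=
    hu_reg.contDiffAt (hΩ.mem_nhds ⟨h₁, h₂⟩)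
  have hcmc (x : ℝ × ℝ) (h₁ : r < nrm x) (h₂ : nrm x < R) : IsCMCAt H u x :=
    isCMCAt_of_div2 (hC2 x h₁ h₂) (hu_spacelike x h₁ h₂) (hu_cmc x h₁ h₂)
  have hle (x y : ℝ × ℝ) (h₁ : r ≤ nrm x) (h₂ : nrm x ≤ R) (hxy : nrm x = nrm y) :
      u x ≤ u y := by
    obtain ⟨c, s, hcs, rfl⟩ := exists_planeRotation_eq (hr.trans_le h₁) hxy
    have hn := nrm_planeRotation hcs
    refine cmc_comparison (H := H) (v := fun x => u (planeRotation c s x)) hΩ hS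
      (fun x hx => ⟨hx.1.le, hx.2.le⟩) hu_cont ?_ hu_reg ?_
      (fun x hx => hu_spacelike x hx.1 hx.2) ?_ (fun x hx => hcmc x hx.1 hx.2) ?_ ?_ x ⟨h₁, h₂⟩
    · refine hu_cont.comp (planeRotation c s).continuous.continuousOn fun x hx => ?_
      simpa only [mem_ofPred_eq, hn] using hx
    · refine hu_reg.comp (planeRotation c s).contDiff.contDiffOn fun x hx => ?_
      simpa only [mem_ofPred_eq, hn, mem_preimage] using hx
    · rintro x ⟨hx₁, hx₂⟩
      rw [← hn x] at hx₁ hx₂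
      rw [grad2_comp_planeRotation ((hC2 _ hx₁ hx₂).differentiableAt (by simp)),
        sqnorm_planeRotation (by simpa using hcs)]
      exact hu_spacelike _ hx₁ hx₂
    · rintro x ⟨hx₁, hx₂⟩
      rw [← hn x] at hx₁ hx₂
      exact (hcmc _ hx₁ hx₂).comp_planeRotation hcs (hC2 _ hx₁ hx₂)
    · rintro x ⟨hx₁, hx₂⟩ hx
      rcases hx₁.eq_or_lt with hr' | hr'
      · rw [hu_a x hr'.symm, hu_a _ ((hn x).trans hr'.symm)]
      · have hR' : nrm x = R := le_antisymm hx₂ (not_lt.1 fun h => hx ⟨hr', h⟩)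
        rw [hu_b x hR', hu_b _ ((hn x).trans hR')]
  refine ⟨fun t => u (t, 0), fun x h₁ h₂ => ?_⟩
  have hn : nrm (nrm x, 0) = nrm x := by
    have : (0 : ℝ) ≤ nrm x := hr.le.trans h₁
    simp [nrm, Real.sqrt_sq (show 0 ≤ √(x.1 ^ 2 + x.2 ^ 2) from this)]
  exact le_antisymm (hle _ _ h₁ h₂ hn.symm) (hle _ _ (h₁.trans_eq hn.symm) (hn.trans_le h₂) hn)
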